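/- arXiv:1409.1004 — 2 statements merged into one kernel-verified Lean document; each statement's English description precedes it below -/
import Mathlib

section
/- Let x ∈ GL_n(ℂ) be diagonalizable and such that for any two eigenvalues λ, μ of x, the ratio λμ^{-1} is not a nontrivial root of unity. Then for every positive integer k, the commutant of x in the matrix algebra equals the commutant of x^k: {A ∈ M_n(ℂ) : xA = Ax} = {A ∈ M_n(ℂ) : x^k A = A x^k}. -/
/-- A matrix commutes with `diagonal d` iff its `(i, j)` entry vanishes unless `d i = d j`. -/
theorem Matrix.commute_diagonal_left_iff {ι R : Type*} [Fintype ι] [DecidableEq ι]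
    [CommRing R] [IsDomain R] (d : ι → R) (B : Matrix ι ι R) :
    Commute (Matrix.diagonal d) B ↔ ∀ i j, B i j ≠ 0 → d i = d j := by
  rw [commute_iff_eq, ← Matrix.ext_iff]
  refine forall₂_congr fun i j => ?_
  rw [Matrix.diagonal_mul, Matrix.mul_diagonal, mul_comm (B i j), mul_eq_mul_right_iff]
  tauto

theorem Units.commute_conj_left_iff {M : Type*} [Monoid M] (u : Mˣ) (a b : M) :
    Commute (↑u * a * ↑u⁻¹) b ↔ Commute a (↑u⁻¹ * b * ↑u) := by
  rw [commute_iff_eq, commute_iff_eq, ← Units.mul_right_inj u⁻¹, ← Units.mul_left_inj u]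
  simp only [mul_assoc, Units.inv_mul_cancel_left, Units.inv_mul, mul_one]

/-- If `x ∈ GL_n(ℂ)` is diagonalizable and no ratio of two of its eigenvalues is a
nontrivial root of unity, then for every positive integer `k` the commutant of `x`
in the matrix algebra equals the commutant of `x ^ k`. -/
theorem commutant_pow_eq_of_neat
    {n : ℕ} (x : GL (Fin n) ℂ)
    (hdiag : ∃ (P : GL (Fin n) ℂ) (d : Fin n → ℂ),
      (x : Matrix (Fin n) (Fin n) ℂ) = (P : Matrix (Fin n) (Fin n) ℂ) *
        Matrix.diagonal d * (P⁻¹ : GL (Fin n) ℂ))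
    (hneat : ∀ lam mu : ℂ, lam ∈ spectrum ℂ (x : Matrix (Fin n) (Fin n) ℂ) →
      mu ∈ spectrum ℂ (x : Matrix (Fin n) (Fin n) ℂ) →
      ∀ m : ℕ, 1 ≤ m → (lam * mu⁻¹) ^ m = 1 → lam * mu⁻¹ = 1)
    (k : ℕ) (hk : 0 < k) :
    {A : Matrix (Fin n) (Fin n) ℂ | (x : Matrix (Fin n) (Fin n) ℂ) * A
        = A * (x : Matrix (Fin n) (Fin n) ℂ)}
      = {A : Matrix (Fin n) (Fin n) ℂ | (x : Matrix (Fin n) (Fin n) ℂ) ^ k * A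
        = A * (x : Matrix (Fin n) (Fin n) ℂ) ^ k} := by
  obtain ⟨P, d, hx⟩ := hdiag
  have hspec : ∀ i, d i ∈ spectrum ℂ (x : Matrix (Fin n) (Fin n) ℂ) := fun i => by
    rw [hx, spectrum.units_conjugate, spectrum_diagonal]
    exact ⟨i, rfl⟩
  have hd : ∀ i, d i ≠ 0 := fun i h =>
    spectrum.zero_notMem ℂ x.isUnit (h ▸ hspec i)
  have hpow : ∀ i j, d i ^ k = d j ^ k ↔ d i = d j := fun i j => by
    refine ⟨fun h => ?_, fun h => by rw [h]⟩
    have hratio := hneat _ _ (hspec i) (hspec j) k hk (by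
      rw [mul_pow, inv_pow, h, mul_inv_cancel₀ (pow_ne_zero k (hd j))])
    exact (mul_inv_eq_one₀ (hd j)).mp hratio
  ext A
  change Commute (x : Matrix (Fin n) (Fin n) ℂ) A ↔
    Commute ((x : Matrix (Fin n) (Fin n) ℂ) ^ k) A
  rw [hx, Units.conj_pow, Matrix.diagonal_pow, Units.commute_conj_left_iff,
    Units.commute_conj_left_iff, Matrix.commute_diagonal_left_iff,
    Matrix.commute_diagonal_left_iff]
  simp only [Pi.pow_apply, hpow]
end

section
/- Let x ∈ GL_n(ℂ) be diagonalizable and such that for any two eigenvalues λ, μ of x, the ratio λμ^{-1} is not a nontrivial root of unity. Then for every positive integer k, the centralizer subgroup of x in GL_n(ℂ) equals the centralizer subgroup of x^k in GL_n(ℂ); in particular, the connected components of the identity in these two centralizers coincide. -/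
/-- A matrix commuting with `diagonal d ^ k` commutes with `diagonal d`, provided that equality of
the `k`-th powers of two entries of `d` forces equality of these entries. -/
theorem Matrix.commute_diagonal_of_commute_pow {ι R : Type*} [Fintype ι] [DecidableEq ι]
    [CommRing R] [IsDomain R] {d : ι → R} {k : ℕ}
    (hd : ∀ i j, d i ^ k = d j ^ k → d i = d j) {A : Matrix ι ι R}
    (hA : Commute (Matrix.diagonal d ^ k) A) : Commute (Matrix.diagonal d) A := by
  ext i j
  have hij := congrFun (congrFun hA.eq i) j
  rw [Matrix.diagonal_pow, Matrix.diagonal_mul, Matrix.mul_diagonal, Pi.pow_apply, Pi.pow_apply,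
    mul_comm (A i j)] at hij
  rw [Matrix.diagonal_mul, Matrix.mul_diagonal, mul_comm (A i j)]
  rcases eq_or_ne (A i j) 0 with h | h
  · simp [h]
  · rw [hd i j (mul_right_cancel₀ h hij)]


/-- If `x ∈ GL_n(ℂ)` is diagonalizable and no ratio of two of its eigenvalues is a
nontrivial root of unity, then for every positive integer `k` the centralizer of `x`
in `GL_n(ℂ)` equals the centralizer of `x ^ k`; in particular the identity components
of the two centralizers coincide. -/
theorem centralizer_pow_eq_of_neat
    {n : ℕ} (x : GL (Fin n) ℂ)
    (hdiag : ∃ (P : GL (Fin n) ℂ) (d : Fin n → ℂ),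
      (x : Matrix (Fin n) (Fin n) ℂ) = (P : Matrix (Fin n) (Fin n) ℂ) *
        Matrix.diagonal d * (P⁻¹ : GL (Fin n) ℂ))
    (hneat : ∀ lam mu : ℂ, lam ∈ spectrum ℂ (x : Matrix (Fin n) (Fin n) ℂ) →
      mu ∈ spectrum ℂ (x : Matrix (Fin n) (Fin n) ℂ) →
      ∀ m : ℕ, 1 ≤ m → (lam * mu⁻¹) ^ m = 1 → lam * mu⁻¹ = 1)
    (k : ℕ) (hk : 0 < k) :
    Subgroup.centralizer ({x} : Set (GL (Fin n) ℂ))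
      = Subgroup.centralizer ({x ^ k} : Set (GL (Fin n) ℂ)) := by
  obtain ⟨P, d, hx⟩ := hdiag
  have hspec : spectrum ℂ (x : Matrix (Fin n) (Fin n) ℂ) = Set.range d := by
    rw [hx, spectrum.units_conjugate, spectrum_diagonal]
  have hmem (i : Fin n) : d i ∈ spectrum ℂ (x : Matrix (Fin n) (Fin n) ℂ) :=
    hspec ▸ Set.mem_range_self i
  have hne (i : Fin n) : d i ≠ 0 := fun h =>
    spectrum.zero_notMem ℂ x.isUnit (h ▸ hmem i)
  have hinj (i j : Fin n) (h : d i ^ k = d j ^ k) : d i = d j := by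
    have hone : (d i * (d j)⁻¹) ^ k = 1 := by
      rw [mul_pow, inv_pow, h, mul_inv_cancel₀ (pow_ne_zero k (hne j))]
    exact (mul_inv_eq_one₀ (hne j)).mp (hneat _ _ (hmem i) (hmem j) k hk hone)
  have hconj : ((P⁻¹ * x * P : GL (Fin n) ℂ) : Matrix (Fin n) (Fin n) ℂ) =
      Matrix.diagonal d := by
    rw [Units.val_mul, Units.val_mul, hx]
    simp only [mul_assoc, Units.inv_mul, Units.inv_mul_cancel_left, mul_one]
  ext g
  simp only [Subgroup.mem_centralizer_singleton_iff]
  refine ⟨fun h => (Commute.pow_right h k).eq, fun h => ?_⟩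
  have hpow : Commute ((P⁻¹ * x * P) ^ k) (P⁻¹ * g * P) := by
    have hc : (P⁻¹ * x * P) ^ k = P⁻¹ * x ^ k * P := by
      simpa using conj_pow (a := P⁻¹) (b := x) (i := k)
    rw [hc]
    simpa using (Commute.conj_iff P⁻¹).mpr (show Commute (x ^ k) g from h.symm)
  have hdiag' : Commute (Matrix.diagonal d)
      ((P⁻¹ * g * P : GL (Fin n) ℂ) : Matrix (Fin n) (Fin n) ℂ) := by
    refine Matrix.commute_diagonal_of_commute_pow hinj ?_
    rw [← hconj, ← Units.val_pow_eq_pow_val]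
    exact hpow.units_val
  rw [← hconj] at hdiag'
  have hxg : Commute (P⁻¹ * x * P) (P⁻¹ * g * P) := hdiag'.units_of_val
  exact ((Commute.conj_iff P⁻¹).mp (by simpa using hxg)).symm.eq
end
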